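/- arXiv:2508.20967 — 2 statements merged into one kernel-verified Lean document; each statement's English description precedes it below -/
import Mathlib

section
/- Let n, T be natural numbers, δ > 0, Δ ≥ 0, let φ : ℕ → ℝ satisfy φ(k+1) ≤ φ(k) for all k < T and φ(0) − φ(T) ≤ Δ, and let m : ℕ → ℕ satisfy m(k) ≤ n for all k. Suppose S and U are sets of natural numbers such that every k < T belongs to S ∪ U, every k < T with k ∈ S satisfies φ(k) − φ(k+1) ≥ δ, and every k < T with k ∈ U satisfies m(k+1) + 1 ≤ m(k). Then T ≤ (n + 1)(1 + Δ/δ). -/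
/-- The counting argument underlying Theorem 2.5: the O(n ε⁻²) iteration
complexity bound for Algorithm 1. -/
theorem active_set_counting
    (n T : ℕ) (δ Δ : ℝ) (hδ : 0 < δ) (hΔ : 0 ≤ Δ)
    (φ : ℕ → ℝ)
    (hmono : ∀ k < T, φ (k + 1) ≤ φ k)
    (htotal : φ 0 - φ T ≤ Δ)
    (m : ℕ → ℕ) (hm : ∀ k, m k ≤ n)
    (S U : Set ℕ)
    (hcover : ∀ k < T, k ∈ S ∪ U)
    (hS : ∀ k < T, k ∈ S → φ k - φ (k + 1) ≥ δ)
    (hU : ∀ k < T, k ∈ U → m (k + 1) + 1 ≤ m k) :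
    (T : ℝ) ≤ (n + 1) * (1 + Δ / δ) := by
  have key : ∀ k ≤ T, δ * (k + m k) ≤ δ * n + (n + 1) * (φ 0 - φ k) := by
    intro k
    induction k with
    | zero =>
      intro _
      have h0 : (m 0 : ℝ) ≤ n := mod_cast hm 0
      simpa using mul_le_mul_of_nonneg_left h0 hδ.le
    | succ k ih =>
      intro hk
      have ihk := ih (by omega)
      push_cast
      rcases hcover k hk with h | h
      · have hm' : (m (k + 1) : ℝ) ≤ n := mod_cast hm (k + 1)
        have hm0 : (0 : ℝ) ≤ m k := by positivity
        have hn : (0 : ℝ) ≤ n + 1 := by positivity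
        have hdec := mul_le_mul_of_nonneg_left (hS k hk h) hn
        have hgrow := mul_le_mul_of_nonneg_left
          (show (k : ℝ) + 1 + m (k + 1) ≤ (k + m k) + (n + 1) by linarith) hδ.le
        linarith
      · have hm' : (m (k + 1) : ℝ) + 1 ≤ m k := mod_cast hU k hk h
        have hn : (0 : ℝ) ≤ n + 1 := by positivity
        have hdec := mul_le_mul_of_nonneg_left (hmono k hk) hn
        have hshrink := mul_le_mul_of_nonneg_left
          (show (k : ℝ) + 1 + m (k + 1) ≤ k + m k by linarith) hδ.le
        linarith
  have hn : (0 : ℝ) ≤ n + 1 := by positivity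
  have hT := key T le_rfl
  have hΔT := mul_le_mul_of_nonneg_left htotal hn
  have hmT : 0 ≤ δ * (m T : ℝ) := by positivity
  refine le_of_mul_le_mul_left ?_ hδ
  calc δ * T ≤ (n + 1) * (δ + Δ) := by linarith
    _ = δ * ((n + 1) * (1 + Δ / δ)) := by field_simp
end

section
/- Let n, T be natural numbers, δ > 0, Δ ≥ 0, let φ : ℕ → ℝ satisfy φ(k+1) ≤ φ(k) for all k < T and φ(0) − φ(T) ≤ Δ, and let m : ℕ → ℕ satisfy m(k) ≤ n for all k. Suppose S₁, S₂ and U are sets of natural numbers such that every k < T belongs to S₁ ∪ S₂ ∪ U, every k < T with k ∈ S₁ satisfies φ(k) − φ(k+1) ≥ δ, every k with k + 1 < T and k ∈ S₂ satisfies k + 1 ∈ S₁, and every k < T with k ∈ U satisfies m(k+1) + 1 ≤ m(k). Then T ≤ 2(n + 1)(1 + Δ/δ). -/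
/-- The counting argument underlying Theorem 2.15: the O(n ε^{-3/2}) iteration
complexity bound for Algorithm 4. -/
theorem active_set_cubic_counting
    (n T : ℕ) (δ Δ : ℝ) (hδ : 0 < δ) (hΔ : 0 ≤ Δ)
    (φ : ℕ → ℝ)
    (hmono : ∀ k < T, φ (k + 1) ≤ φ k)
    (htotal : φ 0 - φ T ≤ Δ)
    (m : ℕ → ℕ) (hm : ∀ k, m k ≤ n)
    (S₁ S₂ U : Set ℕ)
    (hcover : ∀ k < T, k ∈ S₁ ∪ S₂ ∪ U)
    (hS₁ : ∀ k < T, k ∈ S₁ → φ k - φ (k + 1) ≥ δ)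
    (hS₂ : ∀ k, k + 1 < T → k ∈ S₂ → k + 1 ∈ S₁)
    (hU : ∀ k < T, k ∈ U → m (k + 1) + 1 ≤ m k) :
    (T : ℝ) ≤ 2 * (n + 1) * (1 + Δ / δ) := by
  obtain ⟨s, hs, h⟩ : ∃ s : ℕ, s * δ ≤ φ 0 - φ T ∧
      (T + m T ≤ s * (n + 2) + n ∨ (∃ j ∈ S₂, T = j + 1) ∧ T ≤ s * (n + 2) + n + 1) := by
    suffices H : ∀ t ≤ T, ∃ s : ℕ, s * δ ≤ φ 0 - φ t ∧
        (t + m t ≤ s * (n + 2) + n ∨ (∃ j ∈ S₂, t = j + 1) ∧ t ≤ s * (n + 2) + n + 1) from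
      H T le_rfl
    intro t
    induction t with
    | zero => exact fun _ => ⟨0, by simp, Or.inl (by simpa using hm 0)⟩
    | succ t ih =>
      intro ht
      obtain ⟨s, hs, h⟩ := ih (by lia)
      have hdec := hmono t ht
      have hm' := hm (t + 1)
      have descent_step (h₁ : t ∈ S₁) (hb : t ≤ s * (n + 2) + n + 1) :
          ∃ s : ℕ, s * δ ≤ φ 0 - φ (t + 1) ∧ (t + 1 + m (t + 1) ≤ s * (n + 2) + n ∨
            (∃ j ∈ S₂, t + 1 = j + 1) ∧ t + 1 ≤ s * (n + 2) + n + 1) := by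
        have hd := hS₁ t ht h₁
        exact ⟨s + 1, by push_cast; linarith, Or.inl (by rw [add_one_mul]; lia)⟩
      rcases h with hb | ⟨⟨j, hj, rfl⟩, hb⟩
      · rcases hcover t ht with (h₁ | h₂) | hu
        · exact descent_step h₁ (by lia)
        · exact ⟨s, by linarith, Or.inr ⟨⟨t, h₂, rfl⟩, by lia⟩⟩
        · have := hU t ht hu
          exact ⟨s, by linarith, Or.inl (by lia)⟩
      · exact descent_step (hS₂ j ht hj) hb
  have hT : T ≤ s * (n + 2) + n + 1 := by lia
  have hsΔ : (s : ℝ) ≤ Δ / δ := (le_div_iff₀ hδ).2 (hs.trans htotal)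
  calc (T : ℝ) ≤ s * (n + 2) + n + 1 := mod_cast hT
    _ ≤ 2 * (n + 1) * (1 + s) := by
      have : (0 : ℝ) ≤ n * s := by positivity
      nlinarith [n.cast_nonneg (α := ℝ)]
    _ ≤ 2 * (n + 1) * (1 + Δ / δ) := by gcongr
end
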